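/- Set β1 = ρ1/(n-2-nm) and assume mρ1/(n-2-nm) < β ≤ β1. Let f be a positive function on (0,∞) such that r ↦ f(r)^m/m is twice continuously differentiable on (0,∞), (f^m/m)''(r) + ((n-1)/r)·(f^m/m)'(r) + α·f(r) + β·r·f'(r) = 0 for all r > 0, lim_{r→0+} r^{α/β}·f(r) = η, and, with w(r) = r^{α/β}·f(r) and z(s) = e^s·w'(e^s)/w(e^s), 0 < z(s)·e^{-(ρ1/β)s} ≤ C4·η^{m-1} for all s ∈ ℝ. Then there exists a constant C7 > 0 such that r²·f(r)^{1-m} ≤ C7 for all r ≥ 1. -/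

import Mathlib

open Real Set Filter

/-- `z(s) = e^s w'(e^s) / w(e^s)` where `w(r) = r^{α/β} f(r)`. -/
noncomputable def Zfun (α β : ℝ) (f : ℝ → ℝ) (s : ℝ) : ℝ :=
  Real.exp s * deriv (fun r => r ^ (α / β) * f r) (Real.exp s) /
    (Real.exp s ^ (α / β) * f (Real.exp s))

/-- radially symmetric solution of `Δ(f^m/m) + α f + β x·∇f = 0` on `(0,∞)`
with `lim_{r→0+} r^{α/β} f(r) = η`. -/
def FDESol (n : ℕ) (m α β η : ℝ) (f : ℝ → ℝ) : Prop :=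
  (∀ r ∈ Set.Ioi (0 : ℝ), 0 < f r) ∧
  ContDiffOn ℝ 2 (fun r => f r ^ m / m) (Set.Ioi 0) ∧
  (∀ r ∈ Set.Ioi (0 : ℝ),
    deriv (deriv (fun r' => f r' ^ m / m)) r
      + (((n : ℝ) - 1) / r) * deriv (fun r' => f r' ^ m / m) r
      + α * f r + β * r * deriv f r = 0) ∧
  Filter.Tendsto (fun r => r ^ (α / β) * f r) (nhdsWithin 0 (Set.Ioi 0)) (nhds η)

/-- the bound `0 < z(s) e^{-(ρ1/β) s} ≤ C4 η^{m-1}` for all `s ∈ ℝ`. -/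
def FDEZBound (m α β ρ1 η C4 : ℝ) (f : ℝ → ℝ) : Prop :=
  ∀ s : ℝ, 0 < Zfun α β f s * Real.exp (-(ρ1 / β) * s) ∧
    Zfun α β f s * Real.exp (-(ρ1 / β) * s) ≤ C4 * η ^ (m - 1)

open Topology

/-- The coefficients `l`, `K`, `Z` of the barrier argument: the derivative of `log G + l * z` is
negative as soon as `G` or `z` is large. -/
lemma exists_barrier_coeffs {m k c β : ℝ} (C1 C3 : ℝ) (hm : 0 < m) (hk : 0 < k) (hc : 0 < c)
    (hβ : 0 < β) :
    ∃ l K Z : ℝ, 0 < l ∧ ∀ G z : ℝ, 0 < G → 0 < z → (K ≤ G ∨ Z ≤ z) →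
      k * z - c + l * (C3 - m * (z + C1) ^ 2 - β * G * z) < 0 := by
  have hd : 0 < |C3| + 1 := by positivity
  obtain ⟨l, hl, hlC⟩ : ∃ l : ℝ, 0 < l ∧ l * C3 < c := by
    refine ⟨c / (|C3| + 1), by positivity, ?_⟩
    rw [div_mul_eq_mul_div, div_lt_iff₀ hd]
    nlinarith [le_abs_self C3]
  refine ⟨l, k / (l * β), 2 * |C1| + 4 * k / (l * m), hl, ?_⟩
  rintro G z hG hz (h | h)
  · have h1 : k ≤ G * (l * β) := (div_le_iff₀ (by positivity)).1 h
    have h2 : 0 ≤ l * (m * (z + C1) ^ 2) := by positivity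
    nlinarith
  · have h1 : 4 * k ≤ z * (l * m) := by
      rw [← div_le_iff₀ (by positivity)]
      linarith [abs_nonneg C1]
    have h2 : 2 * |C1| ≤ z := by
      have : 0 < 4 * k / (l * m) := by positivity
      linarith
    have h3 : z ^ 2 / 4 ≤ (z + C1) ^ 2 := by
      nlinarith [neg_abs_le C1]
    have h4 : l * m * (z ^ 2 / 4) ≤ l * m * (z + C1) ^ 2 := by gcongr
    have h5 : 0 < l * (β * G * z) := by positivity
    nlinarith

/-- A differentiable function on `[a, ∞)` that is decreasing wherever it is at least `M` is
bounded above. -/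
lemma le_max_of_deriv_neg {Φ Φ' : ℝ → ℝ} {a M : ℝ}
    (hΦ : ∀ x, a ≤ x → HasDerivAt Φ (Φ' x) x)
    (hneg : ∀ x, a ≤ x → M ≤ Φ x → Φ' x < 0) {r : ℝ} (hr : a ≤ r) :
    Φ r ≤ max (Φ a) M := by
  refine image_le_of_deriv_right_lt_deriv_boundary (a := a) (b := r) (f := Φ) (f' := Φ')
    (B := fun _ => max (Φ a) M) (B' := fun _ => 0)
    (fun x hx => (hΦ x hx.1).continuousAt.continuousWithinAt)
    (fun x hx => (hΦ x hx.1).hasDerivWithinAt) (le_max_left _ _)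
    (fun x => hasDerivAt_const x _) (fun x hx h => hneg x hx.1 ?_) (Set.right_mem_Icc.2 hr)
  rw [h]
  exact le_max_right _ _

/-- A positive function is differentiable where its power `f ^ m / m` is. -/
lemma hasDerivAt_of_rpow_div {m r u' : ℝ} {f : ℝ → ℝ} (hm : 0 < m) (hr : 0 < r)
    (hf : ∀ x, 0 < x → 0 < f x) (hu : HasDerivAt (fun x => f x ^ m / m) u' r) :
    HasDerivAt f (f r * (u' / f r ^ m)) r := by
  have hpos := hf r hr
  have h1 : HasDerivAt (fun x => (m * (f x ^ m / m)) ^ (1 / m)) _ r :=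
    (hu.const_mul m).rpow_const (p := 1 / m) (Or.inl (by positivity))
  have h2 : f =ᶠ[𝓝 r] fun x => (m * (f x ^ m / m)) ^ (1 / m) := by
    filter_upwards [lt_mem_nhds hr] with x hx
    rw [mul_div_cancel₀ _ hm.ne', ← Real.rpow_mul (hf x hx).le, mul_one_div_cancel hm.ne',
      Real.rpow_one]
  refine (h1.congr_of_eventuallyEq h2).congr_deriv ?_
  rw [mul_div_cancel₀ _ hm.ne', ← Real.rpow_mul hpos.le, mul_sub, mul_one_div_cancel hm.ne',
    mul_one, Real.rpow_sub hpos, Real.rpow_one]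
  field_simp

/-- The logarithmic slope `q = r f' / f` written through the derivative of `f ^ m / m`. -/
noncomputable def logSlope (m : ℝ) (f : ℝ → ℝ) (r : ℝ) : ℝ :=
  r * deriv (fun x => f x ^ m / m) r / f r ^ m

lemma FDESol.hasDerivAt {n : ℕ} {m α β η : ℝ} {f : ℝ → ℝ} (hf : FDESol n m α β η f)
    (hm : 0 < m) {r : ℝ} (hr : 0 < r) : HasDerivAt f (f r * logSlope m f r / r) r := by
  have hd : DifferentiableAt ℝ (fun x => f x ^ m / m) r :=
    (hf.2.1.differentiableOn (by norm_num)).differentiableAt (Ioi_mem_nhds hr)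
  refine (hasDerivAt_of_rpow_div hm hr hf.1 hd.hasDerivAt).congr_deriv ?_
  unfold logSlope
  field_simp

/-- The first-order equation satisfied by the logarithmic slope. -/
lemma FDESol.hasDerivAt_logSlope {n : ℕ} {m α β η : ℝ} {f : ℝ → ℝ} (hf : FDESol n m α β η f)
    (hm : 0 < m) {r : ℝ} (hr : 0 < r) :
    HasDerivAt (logSlope m f)
      (-(m * logSlope m f r ^ 2 + ((n : ℝ) - 2) * logSlope m f r
        + r ^ 2 * f r ^ (1 - m) * (α + β * logSlope m f r)) / r) r := by
  have hpos : 0 < f r := hf.1 r hr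
  have hf' := hf.hasDerivAt hm hr
  have hu : HasDerivAt (deriv fun x => f x ^ m / m)
      (deriv (deriv fun x => f x ^ m / m) r) r :=
    (((contDiffOn_succ_iff_deriv_of_isOpen (n := 1) isOpen_Ioi).1 hf.2.1).2.2.differentiableOn
      (by norm_num)).differentiableAt (Ioi_mem_nhds hr) |>.hasDerivAt
  have hode := hf.2.2.1 r hr
  rw [hf'.deriv] at hode
  have hq := ((hasDerivAt_id r).mul hu).div
    (hf'.rpow_const (p := m) (Or.inl hpos.ne')) (by positivity)
  refine HasDerivAt.congr_deriv (f := logSlope m f) hq ?_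
  have hv : deriv (fun x => f x ^ m / m) r = logSlope m f r * f r ^ m / r := by
    unfold logSlope
    field_simp
  rw [hv] at hode
  have hw : deriv (deriv fun x => f x ^ m / m) r =
      -(((n : ℝ) - 1) / r * (logSlope m f r * f r ^ m / r) + α * f r
        + β * r * (f r * logSlope m f r / r)) := by linarith
  simp only [id, Pi.mul_apply, hv, hw]
  rw [Real.rpow_sub hpos, Real.rpow_sub hpos, Real.rpow_one]
  field_simp
  ring

lemma FDESol.Zfun_log {n : ℕ} {m α β η : ℝ} {f : ℝ → ℝ} (hf : FDESol n m α β η f)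
    (hm : 0 < m) {r : ℝ} (hr : 0 < r) :
    Zfun α β f (Real.log r) = α / β + logSlope m f r := by
  have hpos : 0 < f r := hf.1 r hr
  have hd : HasDerivAt (fun x => x ^ (α / β) * f x) _ r :=
    (Real.hasDerivAt_rpow_const (p := α / β) (Or.inl hr.ne')).mul (hf.hasDerivAt hm hr)
  have hp : 0 < r ^ (α / β) := by positivity
  unfold Zfun
  rw [Real.exp_log hr, hd.deriv, Real.rpow_sub hr, Real.rpow_one]
  generalize r ^ (α / β) = p at *
  generalize α / β = a
  field_simp

theorem stmt19 (n : ℕ) (m ρ1 η β α β1 C1 C2 C3 C4 : ℝ)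
    (hn : 3 ≤ n) (hm0 : 0 < m) (hm1 : m < ((n : ℝ) - 2) / (n : ℝ))
    (hρ1 : 0 < ρ1) (hη : 0 < η)
    (hα : α = (2 * β + ρ1) / (1 - m))
    (hβ1 : β1 = ρ1 / ((n : ℝ) - 2 - (n : ℝ) * m))
    (hβlow : m * ρ1 / ((n : ℝ) - 2 - (n : ℝ) * m) < β)
    (hβhigh : β ≤ β1)
    (hC1 : C1 = 1 / (2 * m) * ((n : ℝ) - 2 - 2 * m * α / β))
    (hC2 : C2 = α / β * ((n : ℝ) - 2 - m * α / β))
    (hC3 : C3 = C2 + m * C1 ^ 2)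
    (hC4 : C4 = C3 / β)
    (f : ℝ → ℝ) (hf : FDESol n m α β η f) (hz : FDEZBound m α β ρ1 η C4 f) :
    ∃ C7 : ℝ, 0 < C7 ∧ ∀ r : ℝ, 1 ≤ r → r ^ 2 * f r ^ (1 - m) ≤ C7 := by
  have hn0 : (0 : ℝ) < n := by
    have : 0 < n := by omega
    exact_mod_cast this
  have hnm : 0 < (n : ℝ) - 2 - n * m := by
    have := (lt_div_iff₀ hn0).1 hm1
    linarith
  have hm1' : 0 < 1 - m := by nlinarith
  have hβ : 0 < β := lt_trans (by positivity) hβlow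
  obtain ⟨l, K, Z, hl, hneg⟩ :=
    exists_barrier_coeffs C1 C3 hm0 hm1' (div_pos hρ1 hβ) hβ
  have hzpos : ∀ r, 1 ≤ r → 0 < α / β + logSlope m f r := fun r hr => by
    have h := (hz (Real.log r)).1
    rw [hf.Zfun_log hm0 (by linarith)] at h
    exact pos_of_mul_pos_left h (Real.exp_pos _).le
  have hGpos : ∀ r, 1 ≤ r → 0 < r ^ 2 * f r ^ (1 - m) := fun r hr => by
    have : 0 < f r := hf.1 r (zero_lt_one.trans_le hr)
    positivity
  have hlogG : ∀ r, 1 ≤ r →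
      Real.log (r ^ 2 * f r ^ (1 - m)) = 2 * Real.log r + (1 - m) * Real.log (f r) := by
    intro r hr
    have hr0 : 0 < r := by linarith
    have : 0 < f r := hf.1 r hr0
    rw [Real.log_mul (by positivity) (by positivity), Real.log_pow, Real.log_rpow this]
    norm_num
  set Φ : ℝ → ℝ := fun r =>
    2 * Real.log r + (1 - m) * Real.log (f r) + l * (α / β + logSlope m f r) with hΦ
  have hderiv : ∀ r, 1 ≤ r → HasDerivAt Φ
      (((1 - m) * (α / β + logSlope m f r) - ρ1 / β
        + l * (C3 - m * (α / β + logSlope m f r + C1) ^ 2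
          - β * (r ^ 2 * f r ^ (1 - m)) * (α / β + logSlope m f r))) / r) r := by
    intro r hr
    have hr0 : 0 < r := by linarith
    have hpos : 0 < f r := hf.1 r hr0
    refine ((((Real.hasDerivAt_log hr0.ne').const_mul 2).add
      (((hf.hasDerivAt hm0 hr0).log hpos.ne').const_mul (1 - m))).add
      (((hf.hasDerivAt_logSlope hm0 hr0).const_add (α / β)).const_mul l)).congr_deriv ?_
    have ha : (1 - m) * (α / β) = 2 + ρ1 / β := by
      rw [hα]
      field_simp
    have hα' : α = β * (α / β) := by field_simp
    have hC1' : 2 * m * C1 = (n : ℝ) - 2 - 2 * m * (α / β) := by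
      rw [hC1]
      field_simp
    have hC3' : C3 = α / β * ((n : ℝ) - 2 - m * (α / β)) + m * C1 ^ 2 := by
      rw [hC3, hC2, mul_div_assoc]
    generalize logSlope m f r = q at *
    generalize r ^ 2 * f r ^ (1 - m) = G at *
    generalize α / β = a at *
    generalize ρ1 / β = c at *
    have hc : c = (1 - m) * a - 2 := by linarith
    rw [hC3', hα', hc]
    have hnn : (n : ℝ) = 2 * m * C1 + 2 + 2 * m * a := by linarith
    rw [hnn]
    field_simp
    ring
  have hbound := fun r (hr : 1 ≤ r) =>
    le_max_of_deriv_neg (M := Real.log K + l * Z) hderiv (fun x hx hM => by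
      refine div_neg_of_neg_of_pos (hneg _ _ (hGpos x hx) (hzpos x hx) ?_) (by linarith)
      by_contra! h
      have h1 := Real.log_lt_log (hGpos x hx) h.1
      have h2 := mul_lt_mul_of_pos_left h.2 hl
      rw [hlogG x hx] at h1
      simp only [hΦ] at hM
      linarith) hr
  refine ⟨Real.exp (max (Φ 1) (Real.log K + l * Z)), Real.exp_pos _, fun r hr => ?_⟩
  rw [← Real.log_le_iff_le_exp (hGpos r hr), hlogG r hr]
  have h1 := hbound r hr
  have h2 := mul_pos hl (hzpos r hr)
  have h3 : Φ r = 2 * Real.log r + (1 - m) * Real.log (f r) + l * (α / β + logSlope m f r) := rfl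
  linarith
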